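/- Oracle PAC-Bayes bound in expectation: for any λ > 0, the Gibbs posterior ρ̂_λ with density proportional to exp(−λ r(θ)) with respect to π satisfies E_S E_{θ∼ρ̂_λ}[R(θ)] ≤ inf over ρ ∈ P(Θ) of ( E_{θ∼ρ}[R(θ)] + λC²/(8n) + KL(ρ‖π)/λ ). -/

import Mathlib

open MeasureTheory
open scoped ENNReal

/- Kullback-Leibler divergence: `∫ log (dρ/dπ) dρ` when `ρ ≪ π` (and the integral is
well-defined), `+∞` otherwise. -/
open Classical in
noncomputable def KL {Θ : Type*} [MeasurableSpace Θ] (ρ π : Measure Θ) : ℝ≥0∞ :=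
  if ρ ≪ π ∧ Integrable (fun θ => Real.log ((ρ.rnDeriv π) θ).toReal) ρ
  then ENNReal.ofReal (∫ θ, Real.log ((ρ.rnDeriv π) θ).toReal ∂ρ)
  else ⊤

/- The risk `R(θ) = E_{(X,Y)∼P}[ℓ(f_θ(X),Y)]`. -/
noncomputable def risk {X Y Θ : Type*} [MeasurableSpace X] [MeasurableSpace Y]
    (P : Measure (X × Y)) (f : Θ → X → Y) (ℓ : Y → Y → ℝ) (θ : Θ) : ℝ :=
  ∫ p, ℓ (f θ p.1) p.2 ∂P

/- The empirical risk `r(θ) = (1/n) ∑ᵢ ℓ(f_θ(Xᵢ),Yᵢ)` on the sample `ω`. -/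
noncomputable def empRisk {X Y Θ : Type*} (f : Θ → X → Y) (ℓ : Y → Y → ℝ)
    (n : ℕ) (ω : Fin n → X × Y) (θ : Θ) : ℝ :=
  (∑ i, ℓ (f θ (ω i).1) (ω i).2) / n

/- The Gibbs posterior `ρ̂_λ`, with density proportional to `exp (-λ r θ)` w.r.t. `π`. -/
noncomputable def gibbs {X Y Θ : Type*} [MeasurableSpace Θ] (π : Measure Θ)
    (f : Θ → X → Y) (ℓ : Y → Y → ℝ) (lam : ℝ) (n : ℕ) (ω : Fin n → X × Y) : Measure Θ :=
  π.tilted (fun θ => -lam * empRisk f ℓ n ω θ)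

section GibbsVariational

variable {Θ : Type*} [MeasurableSpace Θ] {π : Measure Θ} [IsProbabilityMeasure π] {u v : Θ → ℝ}

lemma integral_tilted_le_log_sub_log (hu : Integrable (fun θ => Real.exp (u θ)) π)
    (hv : Integrable v (π.tilted u)) (hev : Integrable (fun θ => Real.exp (v θ)) (π.tilted u)) :
    ∫ θ, v θ ∂(π.tilted u) ≤
      Real.log (∫ θ, Real.exp (u θ + v θ) ∂π) - Real.log (∫ θ, Real.exp (u θ) ∂π) := by
  have := isProbabilityMeasure_tilted hu
  have hjensen : Real.exp (∫ θ, v θ ∂(π.tilted u)) ≤ ∫ θ, Real.exp (v θ) ∂(π.tilted u) :=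
    convexOn_exp.map_integral_le Real.continuous_exp.continuousOn isClosed_univ (by simp) hv hev
  have hZ : 0 < ∫ θ, Real.exp (u θ) ∂π := integral_exp_pos hu
  rw [integral_exp_tilted] at hjensen
  have hA : 0 < ∫ θ, Real.exp ((u + v) θ) ∂π :=
    (div_pos_iff_of_pos_right hZ).1 ((Real.exp_pos _).trans_le hjensen)
  have := (Real.le_log_iff_exp_le (div_pos hA hZ)).2 hjensen
  rwa [Real.log_div hA.ne' hZ.ne'] at this

/-- The Donsker-Varadhan inequality. -/
lemma integral_sub_log_integral_exp_le_integral_llr {ρ : Measure Θ} [IsProbabilityMeasure ρ]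
    (hρ : ρ ≪ π) (hllr : Integrable (llr ρ π) ρ) (hu : Integrable u ρ)
    (heu : Integrable (fun θ => Real.exp (u θ)) π) :
    ∫ θ, u θ ∂ρ - Real.log (∫ θ, Real.exp (u θ) ∂π) ≤ ∫ θ, llr ρ π θ ∂ρ := by
  have := isProbabilityMeasure_tilted heu
  have h := InformationTheory.integral_llr_add_sub_measure_univ_nonneg
    (hρ.trans (absolutelyContinuous_tilted heu))
    (integrable_llr_tilted_right hρ hu hllr heu)
  rw [integral_llr_tilted_right hρ hu heu hllr, probReal_univ, probReal_univ] at h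
  linarith

end GibbsVariational

/-- Hoeffding's bound on the exponential moment of the deviation of an empirical mean. -/
lemma integral_exp_mul_integral_sub_mean_le {Z : Type*} [MeasurableSpace Z] {P : Measure Z}
    [IsProbabilityMeasure P] {φ : Z → ℝ} (hφ : Measurable φ) {C : ℝ}
    (hb : ∀ z, φ z ∈ Set.Icc 0 C) {n : ℕ} (hn : 0 < n) (t : ℝ) :
    ∫ ω : Fin n → Z, Real.exp (t * (∫ z, φ z ∂P - (∑ i, φ (ω i)) / n))
        ∂(Measure.pi fun _ => P) ≤ Real.exp (t ^ 2 * C ^ 2 / (8 * n)) := by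
  have hn' : (n : ℝ) ≠ 0 := by positivity
  have hprod (ω : Fin n → Z) : Real.exp (t * (∫ z, φ z ∂P - (∑ i, φ (ω i)) / n)) =
      ∏ i, Real.exp (-(t / n) * (φ (ω i) - ∫ z, φ z ∂P)) := by
    rw [← Real.exp_sum, ← Finset.mul_sum, Finset.sum_sub_distrib]
    congr 1
    simp
    field_simp
    ring
  simp_rw [hprod]
  rw [integral_fintype_prod_eq_pow (fun z => Real.exp (-(t / n) * (φ z - ∫ z, φ z ∂P))),
    Fintype.card_fin]
  have hmgf := (ProbabilityTheory.hasSubgaussianMGF_of_mem_Icc (μ := P) hφ.aemeasurable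
    (Filter.Eventually.of_forall hb)).mgf_le (-(t / n))
  refine (pow_le_pow_left₀ (integral_nonneg fun _ => (Real.exp_pos _).le) hmgf n).trans_eq ?_
  rw [← Real.exp_nat_mul]
  congr 1
  simp [div_pow]
  field_simp
  ring

lemma empRisk_mem_Icc {X Y Θ : Type*} {f : Θ → X → Y} {ℓ : Y → Y → ℝ} {C : ℝ} {n : ℕ}
    (hbound : ∀ y' y : Y, ℓ y' y ∈ Set.Icc 0 C) (hn : 0 < n) (ω : Fin n → X × Y)
    (θ : Θ) : empRisk f ℓ n ω θ ∈ Set.Icc 0 C := by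
  have hn' : (0 : ℝ) < n := by positivity
  refine ⟨div_nonneg (Finset.sum_nonneg fun i _ => (hbound _ _).1) hn'.le, ?_⟩
  rw [empRisk, div_le_iff₀ hn']
  calc ∑ i, ℓ (f θ (ω i).1) (ω i).2 ≤ ∑ _i : Fin n, C :=
        Finset.sum_le_sum fun i _ => (hbound _ _).2
    _ = C * n := by simp [mul_comm]

section EmpiricalRisk

variable {X Y Θ : Type*} [MeasurableSpace X] [MeasurableSpace Y] [MeasurableSpace Θ]
  {P : Measure (X × Y)} [IsProbabilityMeasure P] {f : Θ → X → Y} {ℓ : Y → Y → ℝ} {C : ℝ} {n : ℕ}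

lemma measurable_risk (hmeas : Measurable (fun p : Θ × X × Y => ℓ (f p.1 p.2.1) p.2.2)) :
    Measurable (risk P f ℓ) :=
  hmeas.stronglyMeasurable.integral_prod_right'.measurable

lemma measurable_empRisk (hmeas : Measurable (fun p : Θ × X × Y => ℓ (f p.1 p.2.1) p.2.2)) :
    Measurable (fun p : (Fin n → X × Y) × Θ => empRisk f ℓ n p.1 p.2) := by
  unfold empRisk
  refine (Finset.measurable_sum _ fun i _ => ?_).div_const _
  exact hmeas.comp (measurable_snd.prodMk ((measurable_pi_apply i).comp measurable_fst))

lemma risk_mem_Icc (hbound : ∀ y' y : Y, ℓ y' y ∈ Set.Icc 0 C)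
    (hmeas : Measurable (fun p : Θ × X × Y => ℓ (f p.1 p.2.1) p.2.2)) (θ : Θ) :
    risk P f ℓ θ ∈ Set.Icc 0 C := by
  have hint : Integrable (fun p : X × Y => ℓ (f θ p.1) p.2) P :=
    .of_mem_Icc 0 C (hmeas.comp measurable_prodMk_left).aemeasurable (by simp [hbound _ _])
  refine ⟨integral_nonneg fun p => (hbound _ _).1, ?_⟩
  simpa [risk] using integral_mono hint (integrable_const C) fun p => (hbound _ _).2

lemma integral_empRisk (hbound : ∀ y' y : Y, ℓ y' y ∈ Set.Icc 0 C)
    (hmeas : Measurable (fun p : Θ × X × Y => ℓ (f p.1 p.2.1) p.2.2)) (hn : 0 < n) (θ : Θ) :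
    ∫ ω, empRisk f ℓ n ω θ ∂(Measure.pi fun _ => P) = risk P f ℓ θ := by
  have hn' : (n : ℝ) ≠ 0 := by positivity
  have hφ : Measurable (fun p : X × Y => ℓ (f θ p.1) p.2) := hmeas.comp measurable_prodMk_left
  unfold empRisk
  rw [integral_div, integral_finsetSum]
  · have (i : Fin n) : ∫ ω : Fin n → X × Y, ℓ (f θ (ω i).1) (ω i).2 ∂(Measure.pi fun _ => P)
        = risk P f ℓ θ :=
      integral_comp_eval (μ := fun _ : Fin n => P) (i := i)
        (f := fun p : X × Y => ℓ (f θ p.1) p.2) hφ.aestronglyMeasurable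
    simp [this, hn']
  · intro i _
    exact .of_mem_Icc 0 C (hφ.comp (measurable_pi_apply i)).aemeasurable (by simp [hbound _ _])

end EmpiricalRisk

/-- Oracle PAC-Bayes bound in expectation: for any `λ > 0`, the Gibbs posterior satisfies
`E_S E_{θ∼ρ̂_λ}[R(θ)] ≤ inf_ρ ( E_{θ∼ρ}[R(θ)] + λC²/(8n) + KL(ρ‖π)/λ )`. -/
theorem oracle_pac_bayes_bound_in_expectation
    {X Y Θ : Type*} [MeasurableSpace X] [MeasurableSpace Y] [MeasurableSpace Θ]
    (P : Measure (X × Y)) [IsProbabilityMeasure P]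
    (f : Θ → X → Y) (ℓ : Y → Y → ℝ) (C : ℝ) (hC : 0 < C)
    (hmeas : Measurable (fun p : Θ × X × Y => ℓ (f p.1 p.2.1) p.2.2))
    (hbound : ∀ y' y : Y, ℓ y' y ∈ Set.Icc 0 C)
    (π : Measure Θ) [IsProbabilityMeasure π]
    (n : ℕ) (hn : 0 < n) (lam : ℝ) (hlam : 0 < lam) :
    ∫⁻ ω, ∫⁻ θ, ENNReal.ofReal (risk P f ℓ θ) ∂(gibbs π f ℓ lam n ω)
        ∂(Measure.pi fun _ : Fin n => P) ≤
      ⨅ ρ : {ρ : Measure Θ // IsProbabilityMeasure ρ},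
        ((∫⁻ θ, ENNReal.ofReal (risk P f ℓ θ) ∂ρ.1)
          + ENNReal.ofReal (lam * C ^ 2 / (8 * n))
          + KL ρ.1 π / ENNReal.ofReal lam) := by
  refine le_iInf fun ⟨ρ, hρ⟩ => ?_
  dsimp only
  by_cases hKL : ρ ≪ π ∧ Integrable (fun θ => Real.log ((ρ.rnDeriv π) θ).toReal) ρ
  swap
  · rw [KL, if_neg hKL, ENNReal.top_div_of_ne_top ENNReal.ofReal_ne_top, add_top]
    exact le_top
  obtain ⟨hac, hllr⟩ := hKL
  rw [KL, if_pos ⟨hac, hllr⟩, ← ENNReal.ofReal_div_of_pos hlam]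
  set μ : Measure (Fin n → X × Y) := Measure.pi fun _ => P
  set R := risk P f ℓ
  set r := empRisk f ℓ n
  set κ := ∫ θ, Real.log ((ρ.rnDeriv π) θ).toReal ∂ρ
  set L : ℝ := lam ^ 2 * C ^ 2 / (8 * n)
  have hR : Measurable R := measurable_risk hmeas
  have hRb : ∀ θ, R θ ∈ Set.Icc 0 C := risk_mem_Icc hbound hmeas
  have hr : Measurable (fun p : (Fin n → X × Y) × Θ => r p.1 p.2) := measurable_empRisk hmeas
  have hrb : ∀ ω θ, r ω θ ∈ Set.Icc 0 C := empRisk_mem_Icc hbound hn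
  have hrω (ω) : Measurable (r ω) := hr.comp measurable_prodMk_left
  have hRint (ν : Measure Θ) [IsProbabilityMeasure ν] : Integrable R ν :=
    .of_mem_Icc 0 C hR.aemeasurable (.of_forall hRb)
  have hexp_r (ω) : Integrable (fun θ => Real.exp (-lam * r ω θ)) π := by
    refine .of_mem_Icc 0 1 (by fun_prop) (.of_forall fun θ => ⟨(Real.exp_pos _).le, ?_⟩)
    exact Real.exp_le_one_iff.2 (by nlinarith [(hrb ω θ).1])
  have hexp_R (ν : Measure Θ) [IsProbabilityMeasure ν] :
      Integrable (fun θ => Real.exp (lam * R θ)) ν := by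
    refine .of_mem_Icc 0 (Real.exp (lam * C)) (by fun_prop)
      (.of_forall fun θ => ⟨(Real.exp_pos _).le, ?_⟩)
    exact Real.exp_le_exp.2 (mul_le_mul_of_nonneg_left (hRb θ).2 hlam.le)
  have hgap : Integrable (fun p : (Fin n → X × Y) × Θ => Real.exp (lam * (R p.2 - r p.1 p.2)))
      (μ.prod π) := by
    refine .of_mem_Icc 0 (Real.exp (lam * C)) (by fun_prop)
      (.of_forall fun p => ⟨(Real.exp_pos _).le, ?_⟩)
    exact Real.exp_le_exp.2
      (mul_le_mul_of_nonneg_left (by linarith [(hRb p.2).2, (hrb p.1 p.2).1]) hlam.le)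
  have hrint : Integrable (fun p : (Fin n → X × Y) × Θ => r p.1 p.2) (μ.prod ρ) :=
    .of_mem_Icc 0 C hr.aemeasurable (.of_forall fun p => hrb p.1 p.2)
  set A : (Fin n → X × Y) → ℝ := fun ω => ∫ θ, Real.exp (lam * (R θ - r ω θ)) ∂π
  have hA : Integrable A μ := hgap.integral_prod_left
  have hE : Integrable (fun ω => ∫ θ, r ω θ ∂ρ) μ := hrint.integral_prod_left
  have hAle : ∫ ω, A ω ∂μ ≤ Real.exp L := by
    rw [integral_integral_swap hgap]
    have : ∀ θ, ∫ ω, Real.exp (lam * (R θ - r ω θ)) ∂μ ≤ Real.exp L := fun θ =>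
      integral_exp_mul_integral_sub_mean_le (hmeas.comp measurable_prodMk_left)
        (fun _ => hbound _ _) hn lam
    simpa using integral_mono hgap.integral_prod_right (integrable_const (Real.exp L)) this
  have hEeq : ∫ ω, ∫ θ, r ω θ ∂ρ ∂μ = ∫ θ, R θ ∂ρ := by
    rw [integral_integral_swap hrint]
    exact integral_congr_ae (.of_forall fun θ => integral_empRisk hbound hmeas hn θ)
  -- The tangent line of `log` at `exp L` spares the integrability of `log A`.
  set B : (Fin n → X × Y) → ℝ := fun ω =>
    (A ω / Real.exp L + (L + κ - 1)) / lam + ∫ θ, r ω θ ∂ρ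
  have hB : Integrable B μ := (((hA.div_const _).add (integrable_const _)).div_const _).add hE
  have hpost (ω) : IsProbabilityMeasure (gibbs π f ℓ lam n ω) :=
    isProbabilityMeasure_tilted (hexp_r ω)
  have hpoint (ω) : ∫ θ, R θ ∂(gibbs π f ℓ lam n ω) ≤ B ω := by
    have := hpost ω
    have h1 := integral_tilted_le_log_sub_log (v := fun θ => lam * R θ) (hexp_r ω)
      ((hRint (gibbs π f ℓ lam n ω)).const_mul lam) (hexp_R (gibbs π f ℓ lam n ω))
    have h2 := integral_sub_log_integral_exp_le_integral_llr hac hllr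
      ((Integrable.of_mem_Icc 0 C (hrω ω).aemeasurable (.of_forall (hrb ω))).const_mul (-lam))
      (hexp_r ω)
    have hAeq : ∫ θ, Real.exp (-lam * r ω θ + lam * R θ) ∂π = A ω := by
      refine integral_congr_ae (.of_forall fun θ => ?_)
      dsimp only
      congr 1
      ring
    have hApos : 0 < A ω := by
      refine integral_exp_pos (.of_mem_Icc 0 (Real.exp (lam * C)) (by fun_prop)
        (.of_forall fun θ => ⟨(Real.exp_pos _).le, Real.exp_le_exp.2
          (mul_le_mul_of_nonneg_left (by linarith [(hRb θ).2, (hrb ω θ).1]) hlam.le)⟩))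
    have h3 := Real.log_le_sub_one_of_pos (div_pos hApos (Real.exp_pos L))
    rw [Real.log_div hApos.ne' (Real.exp_pos L).ne', Real.log_exp] at h3
    rw [integral_const_mul, hAeq] at h1
    rw [integral_const_mul] at h2
    change lam * ∫ θ, R θ ∂(gibbs π f ℓ lam n ω) ≤ _ at h1
    change _ ≤ κ at h2
    rw [← sub_le_iff_le_add, le_div_iff₀ hlam]
    linarith
  have hRpost (ω) : 0 ≤ ∫ θ, R θ ∂(gibbs π f ℓ lam n ω) := integral_nonneg fun θ => (hRb θ).1
  have hBint : ∫ ω, B ω ∂μ ≤ ∫ θ, R θ ∂ρ + lam * C ^ 2 / (8 * n) + κ / lam := by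
    have hBeq : ∫ ω, B ω ∂μ =
        ((∫ ω, A ω ∂μ) / Real.exp L + (L + κ - 1)) / lam + ∫ θ, R θ ∂ρ := by
      have hA' : Integrable (fun ω => A ω / Real.exp L) μ := hA.div_const _
      have hA'' : Integrable (fun ω => (A ω / Real.exp L + (L + κ - 1)) / lam) μ :=
        (hA'.add (integrable_const _)).div_const lam
      rw [integral_add hA'' hE, hEeq, integral_div, integral_add hA' (integrable_const _),
        integral_div]
      simp
    have hAdiv : (∫ ω, A ω ∂μ) / Real.exp L ≤ 1 := (div_le_one (Real.exp_pos L)).2 hAle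
    have hL : lam * C ^ 2 / (8 * n) = L / lam := by
      simp only [L]
      field_simp
    have hdiv : ((∫ ω, A ω ∂μ) / Real.exp L + (L + κ - 1)) / lam ≤ (L + κ) / lam :=
      div_le_div_of_nonneg_right (by linarith) hlam.le
    rw [hBeq, hL]
    linarith [add_div L κ lam]
  calc ∫⁻ ω, ∫⁻ θ, ENNReal.ofReal (R θ) ∂(gibbs π f ℓ lam n ω) ∂μ
      ≤ ∫⁻ ω, ENNReal.ofReal (B ω) ∂μ := by
        refine lintegral_mono fun ω => ?_
        have := hpost ω
        rw [← ofReal_integral_eq_lintegral_ofReal (hRint _) (.of_forall fun θ => (hRb θ).1)]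
        exact ENNReal.ofReal_le_ofReal (hpoint ω)
    _ = ENNReal.ofReal (∫ ω, B ω ∂μ) :=
        (ofReal_integral_eq_lintegral_ofReal hB
          (.of_forall fun ω => (hRpost ω).trans (hpoint ω))).symm
    _ ≤ ENNReal.ofReal (∫ θ, R θ ∂ρ + lam * C ^ 2 / (8 * n) + κ / lam) :=
        ENNReal.ofReal_le_ofReal hBint
    _ ≤ ENNReal.ofReal (∫ θ, R θ ∂ρ) + ENNReal.ofReal (lam * C ^ 2 / (8 * n))
          + ENNReal.ofReal (κ / lam) :=
        ENNReal.ofReal_add_le.trans (add_le_add_left ENNReal.ofReal_add_le _)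
    _ = _ := by
        rw [ofReal_integral_eq_lintegral_ofReal (hRint ρ) (.of_forall fun θ => (hRb θ).1)]
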